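/- arXiv:1110.3549 — 3 statements merged into one kernel-verified Lean document; each statement's English description precedes it below -/
import Mathlib

section
/- For each positive integer n and each integer m ≥ 11 + 2·⌊log₂(2n−1)⌋, there exists a system U ⊆ E_m which has exactly n solutions in non-negative integers x_1,…,x_m and at most finitely many solutions in integers x_1,…,x_m. -/
/-- An equation of the system `E_m`: either `x_i = 1`, or `x_i + x_j = x_k`,
or `x_i · x_j = x_k`, with indices in `{1,…,m}` (here `Fin m`). -/
inductive Eqn (m : ℕ) : Type where
  | one (i : Fin m) : Eqn m
  | add (i j k : Fin m) : Eqn m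
  | mul (i j k : Fin m) : Eqn m

/-- A valuation `x : Fin m → R` satisfies an equation of `E_m`. -/
def Eqn.holds {R : Type*} [Semiring R] {m : ℕ} (x : Fin m → R) : Eqn m → Prop
  | .one i => x i = 1
  | .add i j k => x i + x j = x k
  | .mul i j k => x i * x j = x k

/-- A number below `2 ^ L` is reached at index `N` of an addition chain starting with `0, 1`,
for every `N ≥ 2 * L + 2`. -/
theorem exists_addition_chain (L : ℕ) : ∀ k N : ℕ, k < 2 ^ L → 2 * L + 2 ≤ N →
    ∃ e : ℕ → ℕ, e 0 = 0 ∧ e 1 = 1 ∧ e N = k ∧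
      ∀ c, 2 ≤ c → c ≤ N → ∃ a < c, ∃ b < c, e a + e b = e c := by
  induction L with
  | zero =>
    intro k N hk hN
    refine ⟨fun i => if i = 1 then 1 else 0, by simp, by simp, ?_, ?_⟩
    · have : N ≠ 1 := by omega
      simp only [this, if_false]
      omega
    · intro c hc _
      have : c ≠ 1 := by omega
      exact ⟨0, by omega, 0, by omega, by simp [this]⟩
  | succ L ih =>
    intro k N hk hN
    obtain ⟨M, rfl⟩ : ∃ M, N = M + 2 := ⟨N - 2, by omega⟩
    rw [pow_succ] at hk
    obtain ⟨e, h0, h1, hM, hc⟩ := ih (k / 2) M (by omega) (by omega)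
    let f : ℕ → ℕ := fun i => if i ≤ M then e i else if i = M + 1 then 2 * (k / 2) else k
    have hf : ∀ i, i ≤ M → f i = e i := fun i hi => if_pos hi
    have hM1 : f (M + 1) = 2 * (k / 2) := by simp [f]
    have hM2 : f (M + 2) = k := by simp [f]
    refine ⟨f, by rw [hf 0 (by omega), h0], by rw [hf 1 (by omega), h1], hM2, ?_⟩
    intro c h2 hcN
    obtain h | rfl | rfl : c ≤ M ∨ c = M + 1 ∨ c = M + 2 := by omega
    · obtain ⟨a, ha, b, hb, hab⟩ := hc c h2 h
      exact ⟨a, ha, b, hb, by rw [hf a (by omega), hf b (by omega), hf c h, hab]⟩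
    · refine ⟨M, by omega, M, by omega, ?_⟩
      rw [hf M le_rfl, hM, hM1]
      omega
    · have hbit : f (k % 2) = k % 2 := by
        rw [hf _ (by omega)]
        rcases Nat.mod_two_eq_zero_or_one k with h | h <;> rw [h] <;> assumption
      refine ⟨M + 1, by omega, k % 2, by omega, ?_⟩
      rw [hM1, hM2, hbit]
      omega

/-- The system computing the powers `2 ^ e i` for `i ≤ N` and factoring `2 ^ e N` as the product
of the last two variables. -/
def powFactorSystem (N : ℕ) (e : ℕ → ℕ) : Set (Eqn (N + 3)) :=
  {E | E = .one ⟨0, by omega⟩ ∨ E = .add ⟨0, by omega⟩ ⟨0, by omega⟩ ⟨1, by omega⟩ ∨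
    E = .mul ⟨N + 1, by omega⟩ ⟨N + 2, by omega⟩ ⟨N, by omega⟩ ∨
    ∃ a b c : Fin (N + 3), (a : ℕ) < c ∧ (b : ℕ) < c ∧ (c : ℕ) ≤ N ∧
      e a + e b = e c ∧ E = .mul a b c}

/-- The valuation sending `i ≤ N` to `2 ^ e i` and the last two variables to `p`. -/
def powFactorValuation {R : Type*} [CommSemiring R] (N : ℕ) (e : ℕ → ℕ) (p : R × R) :
    Fin (N + 3) → R :=
  fun i => if (i : ℕ) ≤ N then 2 ^ e i else if (i : ℕ) = N + 1 then p.1 else p.2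

theorem powFactorValuation_injective {R : Type*} [CommSemiring R] (N : ℕ) (e : ℕ → ℕ) :
    Function.Injective (powFactorValuation (R := R) N e) := by
  intro p q h
  have h1 := congrFun h ⟨N + 1, by omega⟩
  have h2 := congrFun h ⟨N + 2, by omega⟩
  simp only [powFactorValuation] at h1 h2
  exact Prod.ext (by simpa using h1) (by simpa using h2)

theorem setOf_holds_powFactorSystem {R : Type*} [CommSemiring R] {N : ℕ} {e : ℕ → ℕ}
    (hN : 1 ≤ N) (h0 : e 0 = 0) (h1 : e 1 = 1)
    (he : ∀ c, 2 ≤ c → c ≤ N → ∃ a < c, ∃ b < c, e a + e b = e c) :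
    {x : Fin (N + 3) → R | ∀ E ∈ powFactorSystem N e, E.holds x} =
      Set.image (powFactorValuation N e) {p : R × R | p.1 * p.2 = 2 ^ e N} := by
  ext x
  simp only [Set.mem_ofPred_eq, Set.mem_image]
  constructor
  · intro hx
    have hone : x ⟨0, by omega⟩ = 1 := hx _ (Or.inl rfl)
    have htwo : x ⟨0, by omega⟩ + x ⟨0, by omega⟩ = x ⟨1, by omega⟩ := hx _ (Or.inr (Or.inl rfl))
    have hfac : x ⟨N + 1, by omega⟩ * x ⟨N + 2, by omega⟩ = x ⟨N, by omega⟩ :=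
      hx _ (Or.inr (Or.inr (Or.inl rfl)))
    have hpow : ∀ c (hc : c ≤ N), x ⟨c, by omega⟩ = 2 ^ e c := by
      intro c
      induction c using Nat.strong_induction_on with
      | _ c ih =>
        intro hc
        obtain rfl | rfl | h2 : c = 0 ∨ c = 1 ∨ 2 ≤ c := by omega
        · rw [hone, h0, pow_zero]
        · rw [← htwo, hone, h1, pow_one, one_add_one_eq_two]
        · obtain ⟨a, ha, b, hb, hab⟩ := he c h2 hc
          have hmul : x ⟨a, by omega⟩ * x ⟨b, by omega⟩ = x ⟨c, by omega⟩ :=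
            hx _ (Or.inr (Or.inr (Or.inr ⟨⟨a, by omega⟩, ⟨b, by omega⟩, ⟨c, by omega⟩,
              ha, hb, hc, hab, rfl⟩)))
          rw [← hmul, ih a ha (by omega), ih b hb (by omega), ← pow_add, hab]
    refine ⟨(x ⟨N + 1, by omega⟩, x ⟨N + 2, by omega⟩), by rw [hfac, hpow N le_rfl], ?_⟩
    funext ⟨i, hi⟩
    simp only [powFactorValuation]
    split_ifs with hiN hi1
    · exact (hpow i hiN).symm
    · subst hi1
      rfl
    · obtain rfl : i = N + 2 := by omega
      rfl
  · rintro ⟨p, hp, rfl⟩ E (rfl | rfl | rfl | ⟨a, b, c, ha, hb, hc, hab, rfl⟩)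
    · simp [Eqn.holds, powFactorValuation, h0]
    · simp [Eqn.holds, powFactorValuation, h0, h1, hN, one_add_one_eq_two]
    · simpa [Eqn.holds, powFactorValuation] using hp
    · have haN : (a : ℕ) ≤ N := by omega
      have hbN : (b : ℕ) ≤ N := by omega
      simp [Eqn.holds, powFactorValuation, haN, hbN, hc, ← pow_add, hab]

theorem ncard_setOf_mul_eq_two_pow (k : ℕ) :
    {p : ℕ × ℕ | p.1 * p.2 = 2 ^ k}.ncard = k + 1 := by
  have h : {p : ℕ × ℕ | p.1 * p.2 = 2 ^ k} = ↑(2 ^ k).divisorsAntidiagonal := by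
    ext p
    simp
  rw [h, Set.ncard_coe_finset, ← Nat.map_div_right_divisors, Finset.card_map,
    Nat.divisors_prime_pow Nat.prime_two, Finset.card_map, Finset.card_range]

theorem finite_setOf_int_mul_eq_two_pow (k : ℕ) :
    {p : ℤ × ℤ | p.1 * p.2 = 2 ^ k}.Finite := by
  refine (Int.divisorsAntidiag (2 ^ k)).finite_toSet.subset fun p hp => ?_
  simpa using hp

/-- For each positive integer `n` and each `m ≥ 11 + 2·⌊log₂(2n-1)⌋` there is a system
`U ⊆ E_m` with exactly `n` solutions in non-negative integers `x_1,…,x_m` and at most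
finitely many solutions in integers `x_1,…,x_m`. -/
theorem system_with_n_nonneg_solutions_finitely_many_integer (n m : ℕ) (hn : 0 < n)
    (hm : 11 + 2 * Nat.log 2 (2 * n - 1) ≤ m) :
    ∃ U : Set (Eqn m),
      {x : Fin m → ℕ | ∀ e ∈ U, e.holds x}.ncard = n ∧
      {x : Fin m → ℤ | ∀ e ∈ U, e.holds x}.Finite := by
  obtain ⟨N, rfl⟩ : ∃ N, m = N + 3 := ⟨m - 3, by omega⟩
  have hlog : 2 * n - 1 < 2 ^ (Nat.log 2 (2 * n - 1) + 1) :=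
    Nat.lt_pow_succ_log_self one_lt_two _
  rw [pow_succ] at hlog
  obtain ⟨e, h0, h1, hN, he⟩ :=
    exists_addition_chain (Nat.log 2 (2 * n - 1)) (n - 1) N (by omega) (by omega)
  refine ⟨powFactorSystem N e, ?_, ?_⟩
  · rw [setOf_holds_powFactorSystem (by omega) h0 h1 he,
      Set.ncard_image_of_injective _ (powFactorValuation_injective N e),
      ncard_setOf_mul_eq_two_pow, hN, Nat.sub_add_cancel hn]
  · rw [setOf_holds_powFactorSystem (by omega) h0 h1 he]
    exact (finite_setOf_int_mul_eq_two_pow _).image _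
end

section
/- For each integer n ≥ 4 and each integer m ≥ 8 + 2·⌊log₂(n−3)⌋, there exists a system U ⊆ E_m which has exactly n solutions in integers x_1,…,x_m. -/
/-- The integer solutions of a system of equations. -/
def solutions {m : ℕ} (U : Set (Eqn m)) : Set (Fin m → ℤ) :=
  {x | ∀ e ∈ U, e.holds x}

/-- An equation in the first `m` of `m + 1` variables. -/
def Eqn.castSucc {m : ℕ} : Eqn m → Eqn (m + 1)
  | .one i => .one i.castSucc
  | .add i j k => .add i.castSucc j.castSucc k.castSucc
  | .mul i j k => .mul i.castSucc j.castSucc k.castSucc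

/-- Append a value for one more variable to a valuation. -/
def append {m : ℕ} (c : ℤ) (y : Fin m → ℤ) : Fin (m + 1) → ℤ :=
  Fin.snoc (α := fun _ => ℤ) y c

section append

variable {m : ℕ}

@[simp]
theorem append_castSucc (c : ℤ) (y : Fin m → ℤ) (i : Fin m) : append c y i.castSucc = y i := by
  simp [append]

@[simp]
theorem append_last (c : ℤ) (y : Fin m → ℤ) : append c y (Fin.last m) = c := by
  simp [append]

theorem exists_eq_append (x : Fin (m + 1) → ℤ) : ∃ c y, x = append c y :=
  ⟨x (Fin.last m), Fin.init x, by simp [append]⟩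

@[simp]
theorem append_inj {c d : ℤ} {y z : Fin m → ℤ} : append c y = append d z ↔ c = d ∧ y = z := by
  refine ⟨fun h => ⟨by simpa using congrFun h (Fin.last m), funext fun i => ?_⟩, ?_⟩
  · simpa using congrFun h i.castSucc
  · rintro ⟨rfl, rfl⟩; rfl

theorem append_injective (c : ℤ) : Function.Injective (append (m := m) c) :=
  fun _ _ h => (append_inj.1 h).2

theorem append_mem_image {b c : ℤ} {y : Fin m → ℤ} {A : Set (Fin m → ℤ)} :
    append b y ∈ append c '' A ↔ y ∈ A ∧ b = c := by
  simp only [Set.mem_image, append_inj]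
  constructor
  · rintro ⟨z, hz, rfl, rfl⟩
    exact ⟨hz, rfl⟩
  · rintro ⟨hy, rfl⟩
    exact ⟨y, hy, rfl, rfl⟩

@[simp]
theorem Eqn.castSucc_holds_append (e : Eqn m) (c : ℤ) (y : Fin m → ℤ) :
    e.castSucc.holds (append c y) ↔ e.holds y := by
  cases e <;> simp [Eqn.castSucc, Eqn.holds]

theorem append_mem_solutions {U : Set (Eqn m)} {V : Set (Eqn (m + 1))} {c : ℤ} {y : Fin m → ℤ} :
    append c y ∈ solutions (Eqn.castSucc '' U ∪ V) ↔
      y ∈ solutions U ∧ append c y ∈ solutions V := by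
  simp [solutions, or_imp, forall_and]

end append

/-- Some system in `m` variables has a `0`-`1`-valued variable that takes the value `1` in exactly
`p` solutions and the value `0` in exactly one. -/
def HasIndicatorSystem (m p : ℕ) : Prop :=
  ∃ (U : Set (Eqn m)) (t : Fin m), (∀ x ∈ solutions U, x t = 0 ∨ x t = 1) ∧
    {x ∈ solutions U | x t = 1}.encard = p ∧ {x ∈ solutions U | x t = 0}.encard = 1

namespace HasIndicatorSystem

theorem one_one : HasIndicatorSystem 1 1 := by
  have mem (x : Fin 1 → ℤ) : x ∈ solutions {Eqn.mul 0 0 0} ↔ x 0 = 0 ∨ x 0 = 1 := by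
    simp [solutions, Eqn.holds, ← IsIdempotentElem.eq_1, IsIdempotentElem.iff_eq_zero_or_one]
  have fiber (c : ℤ) (hc : c = 0 ∨ c = 1) :
      {x ∈ solutions {Eqn.mul (0 : Fin 1) 0 0} | x 0 = c} = {fun _ => c} := by
    ext x
    simp only [Set.mem_ofPred_eq, mem, Set.mem_singleton_iff, funext_iff, Fin.forall_fin_one]
    grind
  refine ⟨{.mul 0 0 0}, 0, fun x hx => (mem x).1 hx, ?_, ?_⟩
  · simp [fiber 1]
  · simp [fiber 0]

variable {m p : ℕ}

theorem pad (h : HasIndicatorSystem m p) : HasIndicatorSystem (m + 1) p := by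
  obtain ⟨U, t, ht, hp, hq⟩ := h
  set V : Set (Eqn (m + 1)) := {.add (.last m) (.last m) (.last m)} with hV
  have mem (c : ℤ) (y : Fin m → ℤ) : append c y ∈ solutions (Eqn.castSucc '' U ∪ V) ↔
      y ∈ solutions U ∧ c = 0 := by
    rw [append_mem_solutions]
    simp [solutions, hV, Eqn.holds]
  have fiber (d : ℤ) : {x ∈ solutions (Eqn.castSucc '' U ∪ V) | x t.castSucc = d} =
      append 0 '' {x ∈ solutions U | x t = d} := by
    ext x
    obtain ⟨c, y, rfl⟩ := exists_eq_append x
    simp only [append_mem_image, Set.mem_ofPred_eq, mem, append_castSucc]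
    tauto
  refine ⟨Eqn.castSucc '' U ∪ V, t.castSucc, fun x hx => ?_, ?_, ?_⟩
  · obtain ⟨c, y, rfl⟩ := exists_eq_append x
    simpa using ht y ((mem c y).1 hx).1
  · rw [fiber, (append_injective 0).encard_image, hp]
  · rw [fiber, (append_injective 0).encard_image, hq]

theorem succ (h : HasIndicatorSystem m p) : HasIndicatorSystem (m + 1) (p + 1) := by
  obtain ⟨U, t, ht, hp, hq⟩ := h
  set V : Set (Eqn (m + 1)) :=
    {.mul (.last m) (.last m) (.last m), .mul (.last m) t.castSucc t.castSucc} with hV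
  have mem (c : ℤ) (y : Fin m → ℤ) : append c y ∈ solutions (Eqn.castSucc '' U ∪ V) ↔
      y ∈ solutions U ∧ (c = 1 ∨ c = 0 ∧ y t = 0) := by
    rw [append_mem_solutions]
    simp only [solutions, hV, Eqn.holds, Set.mem_insert_iff, Set.mem_singleton_iff,
      forall_eq_or_imp, forall_eq, Set.mem_ofPred_eq, append_last, append_castSucc,
      ← IsIdempotentElem.eq_1, IsIdempotentElem.iff_eq_zero_or_one]
    grind
  have fiber_one : {x ∈ solutions (Eqn.castSucc '' U ∪ V) | x (.last m) = 1} =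
      append 1 '' ({x ∈ solutions U | x t = 1} ∪ {x ∈ solutions U | x t = 0}) := by
    ext x
    obtain ⟨c, y, rfl⟩ := exists_eq_append x
    simp only [append_mem_image, Set.mem_ofPred_eq, mem, append_last, Set.mem_union]
    grind
  have fiber_zero : {x ∈ solutions (Eqn.castSucc '' U ∪ V) | x (.last m) = 0} =
      append 0 '' {x ∈ solutions U | x t = 0} := by
    ext x
    obtain ⟨c, y, rfl⟩ := exists_eq_append x
    simp only [append_mem_image, Set.mem_ofPred_eq, mem, append_last]
    grind
  refine ⟨Eqn.castSucc '' U ∪ V, .last m, fun x hx => ?_, ?_, ?_⟩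
  · obtain ⟨c, y, rfl⟩ := exists_eq_append x
    have := ((mem c y).1 hx).2
    simp only [append_last]
    tauto
  · rw [fiber_one, (append_injective 1).encard_image, Set.encard_union_eq, hp, hq]
    · simp
    · exact Set.disjoint_left.2 fun x h1 h0 => by grind
  · rw [fiber_zero, (append_injective 0).encard_image, hq]

theorem double (h : HasIndicatorSystem m p) : HasIndicatorSystem (m + 1) (2 * p) := by
  obtain ⟨U, t, ht, hp, hq⟩ := h
  set V : Set (Eqn (m + 1)) :=
    {.mul (.last m) (.last m) (.last m), .mul (.last m) t.castSucc (.last m)} with hV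
  have mem (c : ℤ) (y : Fin m → ℤ) : append c y ∈ solutions (Eqn.castSucc '' U ∪ V) ↔
      y ∈ solutions U ∧ (c = 0 ∨ c = 1 ∧ y t = 1) := by
    rw [append_mem_solutions]
    simp only [solutions, hV, Eqn.holds, Set.mem_insert_iff, Set.mem_singleton_iff,
      forall_eq_or_imp, forall_eq, Set.mem_ofPred_eq, append_last, append_castSucc,
      ← IsIdempotentElem.eq_1, IsIdempotentElem.iff_eq_zero_or_one]
    grind
  have fiber_one : {x ∈ solutions (Eqn.castSucc '' U ∪ V) | x t.castSucc = 1} =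
      append 0 '' {x ∈ solutions U | x t = 1} ∪ append 1 '' {x ∈ solutions U | x t = 1} := by
    ext x
    obtain ⟨c, y, rfl⟩ := exists_eq_append x
    simp only [append_mem_image, Set.mem_ofPred_eq, mem, append_castSucc, Set.mem_union]
    grind
  have fiber_zero : {x ∈ solutions (Eqn.castSucc '' U ∪ V) | x t.castSucc = 0} =
      append 0 '' {x ∈ solutions U | x t = 0} := by
    ext x
    obtain ⟨c, y, rfl⟩ := exists_eq_append x
    simp only [append_mem_image, Set.mem_ofPred_eq, mem, append_castSucc]
    grind
  refine ⟨Eqn.castSucc '' U ∪ V, t.castSucc, fun x hx => ?_, ?_, ?_⟩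
  · obtain ⟨c, y, rfl⟩ := exists_eq_append x
    simpa using ht y ((mem c y).1 hx).1
  · rw [fiber_one, Set.encard_union_eq, (append_injective 0).encard_image,
      (append_injective 1).encard_image, hp]
    · push_cast; ring
    · refine Set.disjoint_left.2 fun x h0 h1 => ?_
      obtain ⟨c, y, rfl⟩ := exists_eq_append x
      rw [append_mem_image] at h0 h1
      grind
  · rw [fiber_zero, (append_injective 0).encard_image, hq]

theorem mono {k : ℕ} (h : HasIndicatorSystem m p) (hk : m ≤ k) : HasIndicatorSystem k p :=
  Nat.le_induction h (fun _ _ => pad) k hk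

theorem of_pos (hp : 0 < p) : HasIndicatorSystem (1 + 2 * Nat.log 2 p) p := by
  induction p using Nat.strong_induction_on with
  | _ p ih =>
    obtain rfl | hp2 : p = 1 ∨ 2 ≤ p := by omega
    · simpa using one_one
    · have half := (ih (p / 2) (by omega) (by omega)).double
      have hlog := Nat.log_of_one_lt_of_le one_lt_two hp2
      obtain hpar | hpar := Nat.mod_two_eq_zero_or_one p
      · rw [show 2 * (p / 2) = p by omega] at half
        exact half.mono (by omega)
      · have := half.succ
        rw [show 2 * (p / 2) + 1 = p by omega] at this
        exact this.mono (by omega)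

theorem exists_encard_solutions (h : HasIndicatorSystem m p) :
    ∃ U : Set (Eqn m), (solutions U).encard = (p + 1 : ℕ) := by
  obtain ⟨U, t, ht, hp, hq⟩ := h
  have split : solutions U = {x ∈ solutions U | x t = 1} ∪ {x ∈ solutions U | x t = 0} := by
    ext x
    have := ht x
    simp only [Set.mem_union, Set.mem_ofPred_eq]
    tauto
  refine ⟨U, ?_⟩
  rw [split, Set.encard_union_eq, hp, hq]
  · simp
  · exact Set.disjoint_left.2 fun x h1 h0 => by grind

end HasIndicatorSystem

/-- For each `n ≥ 4` and each `m ≥ 8 + 2·⌊log₂(n-3)⌋` there is a system `U ⊆ E_m`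
with exactly `n` solutions in integers `x_1,…,x_m`. -/
theorem system_with_n_integer_solutions (n m : ℕ) (hn : 4 ≤ n)
    (hm : 8 + 2 * Nat.log 2 (n - 3) ≤ m) :
    ∃ U : Set (Eqn m),
      {x : Fin m → ℤ | ∀ e ∈ U, e.holds x}.Finite ∧
      {x : Fin m → ℤ | ∀ e ∈ U, e.holds x}.ncard = n := by
  have hlog : Nat.log 2 (n - 1) ≤ Nat.log 2 (n - 3) + 2 := by
    have hlt := Nat.lt_pow_succ_log_self one_lt_two (n - 3)
    refine Nat.lt_succ_iff.1 (Nat.log_lt_of_lt_pow (by omega) ?_)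
    rw [pow_succ] at hlt
    rw [Nat.succ_eq_add_one, pow_succ, pow_succ, pow_succ]
    omega
  obtain ⟨U, hU⟩ := ((HasIndicatorSystem.of_pos (p := n - 1) (by omega)).mono
    (k := m) (by omega)).exists_encard_solutions
  rw [Nat.sub_add_cancel (by omega)] at hU
  exact ⟨U, Set.finite_of_encard_eq_coe hU, congrArg ENat.toNat hU⟩
end

section
/- There exists a constant C > 0 such that for each positive integer n there exist a positive integer m ≤ C·(⌊log₂(n)⌋ + 1) and a system U ⊆ E_m which has exactly n solutions in real numbers x_1,…,x_m. -/
/-- Renaming of variables in an equation. -/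
def Eqn.map {m k : ℕ} (f : Fin m → Fin k) : Eqn m → Eqn k
  | .one i => .one (f i)
  | .add i j l => .add (f i) (f j) (f l)
  | .mul i j l => .mul (f i) (f j) (f l)

theorem Eqn.holds_map {R : Type*} [Semiring R] {m k : ℕ} (f : Fin m → Fin k)
    (x : Fin k → R) (e : Eqn m) : (e.map f).holds x ↔ e.holds (x ∘ f) := by
  cases e <;> rfl

/-- Some system in `m` variables has the finite real solution set `F`. Moreover one variable
vanishes on `F`, and another one is the indicator function of a single point of `F`. -/
def HasMarkedSystem (m : ℕ) (F : Finset (Fin m → ℝ)) : Prop :=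
  ∃ (U : Set (Eqn m)) (z i : Fin m) (p : Fin m → ℝ),
    (∀ x, (∀ e ∈ U, e.holds x) ↔ x ∈ F) ∧ p ∈ F ∧
      ∀ x ∈ F, x z = 0 ∧ (x = p ∧ x i = 1 ∨ x ≠ p ∧ x i = 0)

theorem hasMarkedSystem_singleton : HasMarkedSystem 2 {![0, 1]} := by
  refine ⟨{.add 0 0 0, .one 1}, 0, 1, ![0, 1], fun x => ?_, by simp, by simp⟩
  simp [Eqn.holds, funext_iff, Fin.forall_fin_two]

/-- A point extended by two new leading coordinates, the first being a function of the rest. -/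
def extendPoint {m : ℕ} (g : (Fin m → ℝ) × ℝ → ℝ) (q : (Fin m → ℝ) × ℝ) : Fin (m + 2) → ℝ :=
  Fin.cons (g q) (Fin.cons q.2 q.1 : Fin (m + 1) → ℝ)

theorem extendPoint_injective {m : ℕ} (g : (Fin m → ℝ) × ℝ → ℝ) :
    Function.Injective (extendPoint g) := by
  rintro ⟨x, b⟩ ⟨y, c⟩ h
  have heq := Fin.cons_injective2 (Fin.cons_injective2 h).2
  exact Prod.ext heq.2 heq.1

open Classical in
/-- If the equations `V` cut out, above `F`, the graph of `g` over `P`, then adding them to a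
system for `F` gives a system for that graph. -/
theorem exists_system_image_extendPoint {m : ℕ} {U : Set (Eqn m)} {F : Finset (Fin m → ℝ)}
    (hU : ∀ x, (∀ e ∈ U, e.holds x) ↔ x ∈ F) (V : Set (Eqn (m + 2)))
    (g : (Fin m → ℝ) × ℝ → ℝ) (P : Finset ((Fin m → ℝ) × ℝ))
    (hV : ∀ x b c, (x ∈ F ∧ ∀ e ∈ V, e.holds (Fin.cons c (Fin.cons b x : Fin (m + 1) → ℝ))) ↔
      (x, b) ∈ P ∧ c = g (x, b)) :
    ∃ U' : Set (Eqn (m + 2)),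
      ∀ x, (∀ e ∈ U', e.holds x) ↔ x ∈ P.image (extendPoint g) := by
  refine ⟨Eqn.map (fun i => i.succ.succ) '' U ∪ V, fun y => ?_⟩
  obtain ⟨c, y, rfl⟩ : ∃ c y', y = Fin.cons c y' := ⟨_, _, (Fin.cons_self_tail y).symm⟩
  obtain ⟨b, x, rfl⟩ : ∃ b x, y = Fin.cons b x := ⟨_, _, (Fin.cons_self_tail y).symm⟩
  have hcomp : (Fin.cons c (Fin.cons b x : Fin (m + 1) → ℝ) : Fin (m + 2) → ℝ) ∘
      (fun i : Fin m => i.succ.succ) = x := by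
    funext i
    simp
  have hU' : (∀ e ∈ Eqn.map (fun i : Fin m => i.succ.succ) '' U ∪ V,
      e.holds (Fin.cons c (Fin.cons b x : Fin (m + 1) → ℝ) : Fin (m + 2) → ℝ)) ↔
      (x ∈ F ∧ ∀ e ∈ V, e.holds (Fin.cons c (Fin.cons b x : Fin (m + 1) → ℝ))) := by
    rw [← hU]
    simp only [Set.mem_union, or_imp, forall_and, Set.forall_mem_image, Eqn.holds_map, hcomp]
  rw [hU', hV, Finset.mem_image]
  constructor
  · rintro ⟨hP, rfl⟩
    exact ⟨_, hP, rfl⟩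
  · rintro ⟨⟨x', b'⟩, hP, h⟩
    obtain ⟨hc, h⟩ := Fin.cons_injective2 h
    obtain ⟨rfl, rfl⟩ := Fin.cons_injective2 h
    exact ⟨hP, hc.symm⟩

theorem HasMarkedSystem.exists_card_two_mul {m : ℕ} {F : Finset (Fin m → ℝ)}
    (h : HasMarkedSystem m F) :
    ∃ F' : Finset (Fin (m + 2) → ℝ), F'.card = 2 * F.card ∧ HasMarkedSystem (m + 2) F' := by
  classical
  obtain ⟨U, z, i, p, hU, hp, hF⟩ := h
  let g : (Fin m → ℝ) × ℝ → ℝ := fun q => q.1 i * q.2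
  let P : Finset ((Fin m → ℝ) × ℝ) := F ×ˢ {0, 1}
  obtain ⟨U', hU'⟩ := exists_system_image_extendPoint hU
    {.mul 1 1 1, .mul i.succ.succ 1 0} g P (fun x b c => by
      simp [P, g, Eqn.holds]
      grind)
  refine ⟨P.image (extendPoint g), ?_, U', z.succ.succ, 0, extendPoint g (p, 1), hU', ?_, ?_⟩
  · rw [Finset.card_image_of_injective _ (extendPoint_injective g)]
    simp [P, mul_comm]
  · exact Finset.mem_image_of_mem _ (by simp [P, hp])
  · simp only [Finset.forall_mem_image, (extendPoint_injective g).eq_iff, ne_eq]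
    rintro ⟨x, b⟩ hq
    simp only [P, Finset.mem_product, Finset.mem_insert, Finset.mem_singleton] at hq
    obtain ⟨hx, hb⟩ := hq
    obtain ⟨hz, hi⟩ := hF x hx
    refine ⟨by simpa [extendPoint] using hz, ?_⟩
    rcases hi with ⟨h1, h2⟩ | ⟨h1, h2⟩ <;> rcases hb with rfl | rfl <;>
      simp [extendPoint, g, h1, h2] <;> simp [← h1, h2]

theorem HasMarkedSystem.exists_card_two_mul_sub_one {m : ℕ} {F : Finset (Fin m → ℝ)}
    (h : HasMarkedSystem m F) :
    ∃ F' : Finset (Fin (m + 2) → ℝ), F'.card = 2 * F.card - 1 ∧ HasMarkedSystem (m + 2) F' := by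
  classical
  obtain ⟨U, z, i, p, hU, hp, hF⟩ := h
  let g : (Fin m → ℝ) × ℝ → ℝ := fun q => q.1 i
  let P : Finset ((Fin m → ℝ) × ℝ) := (F ×ˢ {0, 1}).erase (p, 1)
  obtain ⟨U', hU'⟩ := exists_system_image_extendPoint hU
    {.mul 1 1 1, .mul i.succ.succ 1 z.succ.succ, .add z.succ.succ i.succ.succ 0} g P
    (fun x b c => by
      by_cases hx : x ∈ F
      · obtain ⟨hz, hi⟩ := hF x hx
        rcases hi with ⟨h1, h2⟩ | ⟨h1, h2⟩
        · subst h1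
          simp [P, g, Eqn.holds, hx, hz, h2]
          grind
        · simp [P, g, Eqn.holds, hx, hz, h1, h2]
          grind
      · simp [P, hx])
  refine ⟨P.image (extendPoint g), ?_, U', z.succ.succ, 0, extendPoint g (p, 0), hU', ?_, ?_⟩
  · rw [Finset.card_image_of_injective _ (extendPoint_injective g),
      Finset.card_erase_of_mem (by simp [hp])]
    simp [mul_comm]
  · exact Finset.mem_image_of_mem _ (by simp [P, hp])
  · simp only [Finset.forall_mem_image, (extendPoint_injective g).eq_iff, ne_eq]
    rintro ⟨x, b⟩ hq
    simp only [P, Finset.mem_erase, Finset.mem_product, Finset.mem_insert,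
      Finset.mem_singleton] at hq
    obtain ⟨hne, hx, hb⟩ := hq
    obtain ⟨hz, hi⟩ := hF x hx
    refine ⟨by simpa [extendPoint] using hz, ?_⟩
    rcases hi with ⟨h1, h2⟩ | ⟨h1, h2⟩
    · subst h1
      have hb0 : b = 0 := hb.resolve_right fun hb1 => hne (by rw [hb1])
      simp [extendPoint, g, h2, hb0]
    · simp [extendPoint, g, h1, h2]

theorem exists_hasMarkedSystem_card_eq (n : ℕ) (hn : 0 < n) :
    ∃ F : Finset (Fin (2 * Nat.clog 2 n + 2) → ℝ),
      F.card = n ∧ HasMarkedSystem (2 * Nat.clog 2 n + 2) F := by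
  induction n using Nat.strong_induction_on with
  | _ n ih =>
    rcases Nat.lt_or_ge n 2 with h | h
    · obtain rfl : n = 1 := by omega
      rw [Nat.clog_one_right]
      exact ⟨_, Finset.card_singleton _, hasMarkedSystem_singleton⟩
    · obtain ⟨F, hcard, hF⟩ := ih ((n + 2 - 1) / 2) (by omega) (by omega)
      rw [Nat.clog_of_two_le one_lt_two h, mul_add_one]
      rcases Nat.even_or_odd' n with ⟨k, hk | hk⟩
      · obtain ⟨G, hcard_eq, hmarked⟩ := hF.exists_card_two_mul
        exact ⟨G, by omega, hmarked⟩
      · obtain ⟨G, hcard_eq, hmarked⟩ := hF.exists_card_two_mul_sub_one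
        exact ⟨G, by omega, hmarked⟩

/-- There is a constant `C > 0` such that for each positive integer `n` there are a
positive integer `m ≤ C·(⌊log₂ n⌋ + 1)` and a system `U ⊆ E_m` with exactly `n`
solutions in real numbers `x_1,…,x_m`. -/
theorem system_with_n_real_solutions_log_size :
    ∃ C : ℕ, 0 < C ∧ ∀ n : ℕ, 0 < n →
      ∃ m : ℕ, 0 < m ∧ m ≤ C * (Nat.log 2 n + 1) ∧
        ∃ U : Set (Eqn m),
          {x : Fin m → ℝ | ∀ e ∈ U, e.holds x}.Finite ∧
          {x : Fin m → ℝ | ∀ e ∈ U, e.holds x}.ncard = n := by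
  refine ⟨4, by norm_num, fun n hn => ?_⟩
  obtain ⟨F, hcard, U, _, _, _, hU, _⟩ := exists_hasMarkedSystem_card_eq n hn
  have hlog : Nat.clog 2 n ≤ Nat.log 2 n + 1 :=
    (Nat.clog_le_iff_le_pow one_lt_two).2 (Nat.lt_pow_succ_log_self one_lt_two n).le
  refine ⟨_, by omega, by omega, U, ?_⟩
  have hset : {x : Fin (2 * Nat.clog 2 n + 2) → ℝ | ∀ e ∈ U, e.holds x} = F := Set.ext hU
  rw [hset, Set.ncard_coe_finset]
  exact ⟨F.finite_toSet, hcard⟩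
end
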